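/- arXiv:2103.15251 — 11 statements merged into one kernel-verified Lean document; each statement's English description precedes it below -/
import Mathlib

section
/- Let a, b > 0 and let z > 0 satisfy tan(z) = z. Set L := √(b/a)·z and define f(ξ) := cos(z)·√(a/b)·ξ − sin(√(a/b)·ξ). Then a·f(ξ) + b·f''(ξ) = a·cos(z)·√(a/b)·ξ for every ξ ∈ ℝ, and moreover f(L) = f(−L) = 0 and f'(L) = f'(−L) = 0. -/
open Real

theorem hasDerivAt_linear_sub_sin (c k ξ : ℝ) :
    HasDerivAt (fun ξ => c * k * ξ - Real.sin (k * ξ)) (c * k - Real.cos (k * ξ) * k) ξ := by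
  have hlin : ∀ r : ℝ, HasDerivAt (fun ξ => r * ξ) r ξ := fun r => by
    simpa using (hasDerivAt_id ξ).const_mul r
  exact (hlin (c * k)).sub (hlin k).sin

theorem hasDerivAt_const_sub_cos_mul (c k ξ : ℝ) :
    HasDerivAt (fun ξ => c * k - Real.cos (k * ξ) * k) (k ^ 2 * Real.sin (k * ξ)) ξ := by
  have hlin : HasDerivAt (fun ξ => k * ξ) k ξ := by
    simpa using (hasDerivAt_id ξ).const_mul k
  exact ((hlin.cos.mul_const k).const_sub (c * k)).congr_deriv (by ring)

/-- The non-symmetric profile f(ξ) = cos(z)·√(a/b)·ξ − sin(√(a/b)·ξ),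
with tan(z) = z, z > 0, satisfies a·f + b·f'' = a·cos(z)·√(a/b)·ξ and vanishes,
together with its derivative, at the cut-off points ±L = ±√(b/a)·z. -/
theorem kp_nonsymmetric_compacton_profile
    (a b z : ℝ) (ha : 0 < a) (hb : 0 < b) (hz : 0 < z) (htan : Real.tan z = z)
    (L : ℝ) (hL : L = Real.sqrt (b / a) * z)
    (f : ℝ → ℝ)
    (hf : f = fun ξ => Real.cos z * Real.sqrt (a / b) * ξ - Real.sin (Real.sqrt (a / b) * ξ)) :
    (∀ ξ : ℝ, a * f ξ + b * deriv (deriv f) ξ = a * Real.cos z * Real.sqrt (a / b) * ξ)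
    ∧ f L = 0 ∧ f (-L) = 0 ∧ deriv f L = 0 ∧ deriv f (-L) = 0 := by
  have hksq : b * Real.sqrt (a / b) ^ 2 = a := by
    rw [Real.sq_sqrt (by positivity)]
    field_simp
  have hkL : Real.sqrt (a / b) * L = z := by
    rw [hL, ← mul_assoc, ← Real.sqrt_mul (by positivity)]
    field_simp
    simp
  have hcos : Real.cos z ≠ 0 := fun h => by
    rw [Real.tan_eq_sin_div_cos, h, div_zero] at htan
    exact hz.ne htan
  have hsin : Real.sin z = Real.cos z * z := by
    rw [← Real.tan_mul_cos hcos, htan, mul_comm]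
  generalize Real.sqrt (a / b) = k at *
  have hf' : deriv f = fun ξ => Real.cos z * k - Real.cos (k * ξ) * k := by
    funext ξ
    rw [hf]
    exact (hasDerivAt_linear_sub_sin _ k ξ).deriv
  refine ⟨fun ξ => ?_, ?_, ?_, ?_, ?_⟩
  · rw [hf', (hasDerivAt_const_sub_cos_mul _ k ξ).deriv, hf]
    linear_combination Real.sin (k * ξ) * hksq
  · simp [hf, mul_assoc, hkL, hsin]
  · simp [hf, mul_assoc, hkL, hsin]
  · simp [hf', hkL]
  · simp [hf', hkL]
end

section
/- Let m > 1 and A, B > 0, and define U(ξ) := (B/A)^{1/(m−1)} · sech(((m−1)·√B/2)·ξ)^{2/(m−1)}, where sech(x) = 1/cosh(x). Then U is strictly positive and satisfies U'(ξ)² = B·U(ξ)² − A·U(ξ)^{m+1} for every ξ ∈ ℝ (real powers of the positive function U). -/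
open Real

/-- The logarithmic derivative of `sech (k x) ^ p` is `-p k tanh (k x)`. -/
lemma hasDerivAt_sech_rpow (k p x : ℝ) :
    HasDerivAt (fun y => (1 / Real.cosh (k * y)) ^ p)
      (-(p * k * (Real.sinh (k * x) / Real.cosh (k * x))) * (1 / Real.cosh (k * x)) ^ p) x := by
  have hc := Real.cosh_pos (k * x)
  have hlin : HasDerivAt (fun y : ℝ => k * y) k x := by
    simpa using (hasDerivAt_id x).const_mul k
  have h := (hlin.cosh.fun_inv hc.ne').rpow_const (p := p) (Or.inl (inv_ne_zero hc.ne'))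
  simp only [one_div]
  convert h using 1
  rw [Real.rpow_sub_one (inv_ne_zero hc.ne')]
  field_simp

/-- The sech-profile line soliton of the generalized KP equation:
U(ξ) = (B/A)^{1/(m−1)}·sech(((m−1)√B/2)·ξ)^{2/(m−1)} is positive and satisfies
U'² = B·U² − A·U^{m+1}. -/
theorem kp_sech_soliton
    (m A B : ℝ) (hm : 1 < m) (hA : 0 < A) (hB : 0 < B)
    (U : ℝ → ℝ)
    (hU : U = fun ξ => (B / A) ^ (1 / (m - 1))
      * (1 / Real.cosh ((m - 1) * Real.sqrt B / 2 * ξ)) ^ (2 / (m - 1))) :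
    (∀ ξ : ℝ, 0 < U ξ)
    ∧ ∀ ξ : ℝ, deriv U ξ ^ 2 = B * U ξ ^ 2 - A * U ξ ^ (m + 1) := by
  have hm' : m - 1 ≠ 0 := (sub_pos.2 hm).ne'
  have hBA : 0 < B / A := div_pos hB hA
  have hpos : ∀ ξ, 0 < U ξ := fun ξ => by
    have := Real.cosh_pos ((m - 1) * √B / 2 * ξ)
    rw [hU]
    positivity
  refine ⟨hpos, fun ξ => ?_⟩
  set k := (m - 1) * √B / 2 with hk
  have hc := Real.cosh_pos (k * ξ)
  have hs : 0 < 1 / Real.cosh (k * ξ) := one_div_pos.2 hc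
  have hderiv : deriv U ξ = -√B * (Real.sinh (k * ξ) / Real.cosh (k * ξ)) * U ξ := by
    have h := ((hasDerivAt_sech_rpow k (2 / (m - 1)) ξ).const_mul
      ((B / A) ^ (1 / (m - 1)))).deriv
    have hpk : 2 / (m - 1) * k = √B := by rw [hk]; field_simp
    rw [hU, h, hpk]
    ring
  have hpow : U ξ ^ (m - 1) = B / A * (1 / Real.cosh (k * ξ)) ^ 2 := by
    simp only [hU]
    rw [Real.mul_rpow (by positivity) (by positivity), ← Real.rpow_mul hBA.le,
      ← Real.rpow_mul hs.le, div_mul_cancel₀ _ hm', div_mul_cancel₀ _ hm', Real.rpow_one,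
      Real.rpow_two]
  have hsplit : U ξ ^ (m + 1) = U ξ ^ (m - 1) * U ξ ^ 2 := by
    rw [← Real.rpow_two, ← Real.rpow_add (hpos ξ)]
    ring_nf
  rw [hsplit, hpow, hderiv, mul_pow, mul_pow, neg_sq, Real.sq_sqrt hB.le, div_pow, Real.sinh_sq]
  field_simp
end

section
/- Let 1 < m < 2 and A, B > 0, and define U(ξ) := (A/B + ((m−1)²·B/4)·ξ²)^{−1/(m−1)}. Then U is strictly positive and satisfies U'(ξ)² = B·U(ξ)^{1+m} − A·U(ξ)^{2m} for every ξ ∈ ℝ (real powers of the positive function U). -/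
open Real

/-- The heavy-tail solitary wave
U(ξ) = (A/B + ((m−1)²B/4)·ξ²)^{−1/(m−1)}, 1 < m < 2, is positive and satisfies
U'² = B·U^{1+m} − A·U^{2m}. -/
theorem kp_heavy_tail_soliton_superlinear
    (m A B : ℝ) (hm1 : 1 < m) (hm2 : m < 2) (hA : 0 < A) (hB : 0 < B)
    (U : ℝ → ℝ)
    (hU : U = fun ξ => (A / B + (m - 1) ^ 2 * B / 4 * ξ ^ 2) ^ (-(1 / (m - 1)))) :
    (∀ ξ : ℝ, 0 < U ξ)
    ∧ ∀ ξ : ℝ, deriv U ξ ^ 2 = B * U ξ ^ (1 + m) - A * U ξ ^ (2 * m) := by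
  have hm : m - 1 ≠ 0 := by linarith
  have hQ : ∀ ξ : ℝ, 0 < A / B + (m - 1) ^ 2 * B / 4 * ξ ^ 2 := fun ξ => by positivity
  subst hU
  refine ⟨fun ξ => rpow_pos_of_pos (hQ ξ) _, fun ξ => ?_⟩
  have hd : HasDerivAt (fun ξ : ℝ => A / B + (m - 1) ^ 2 * B / 4 * ξ ^ 2)
      ((m - 1) ^ 2 * B / 4 * (2 * ξ)) ξ := by
    simpa using ((hasDerivAt_pow 2 ξ).const_mul ((m - 1) ^ 2 * B / 4)).const_add (A / B)
  rw [(hd.rpow_const (p := -(1 / (m - 1))) (Or.inl (hQ ξ).ne')).deriv]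
  have hBQ : B * (A / B + (m - 1) ^ 2 * B / 4 * ξ ^ 2) - A = ((m - 1) * B / 2 * ξ) ^ 2 := by
    field_simp
    ring
  have hpos := hQ ξ
  dsimp only
  generalize A / B + (m - 1) ^ 2 * B / 4 * ξ ^ 2 = Q at hBQ hpos ⊢
  have h_two_mul : (Q ^ (-(1 / (m - 1)))) ^ (2 * m) = (Q ^ (-(1 / (m - 1)) - 1)) ^ 2 := by
    rw [← rpow_mul hpos.le, ← rpow_natCast, ← rpow_mul hpos.le]
    congr 1
    push_cast
    field_simp
    ring
  have h_one_add : (Q ^ (-(1 / (m - 1)))) ^ (1 + m) = Q * (Q ^ (-(1 / (m - 1)) - 1)) ^ 2 := by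
    rw [← rpow_mul hpos.le, ← rpow_natCast, ← rpow_mul hpos.le, ← rpow_one_add' hpos.le]
    · congr 1
      push_cast
      field_simp
      ring
    · have : 0 < 1 / (m - 1) := one_div_pos.mpr (by linarith)
      push_cast
      linarith
  have h_coeff : (m - 1) ^ 2 * B / 4 * (2 * ξ) * -(1 / (m - 1)) = -((m - 1) * B / 2 * ξ) := by
    field_simp
    ring
  rw [h_two_mul, h_one_add, h_coeff, mul_pow, neg_sq, ← hBQ]
  ring
end

section
/- Let 0 < m < 1 and A, B < 0, and define U(ξ) := |A/B|^{1/(1−m)} · sech(((1−m)·√|A|/2)·ξ)^{2/(1−m)}, where sech(x) = 1/cosh(x). Then U is strictly positive and satisfies U'(ξ)² = B·U(ξ)^{3−m} − A·U(ξ)² for every ξ ∈ ℝ (real powers of the positive function U). -/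
theorem hasDerivAt_one_div_cosh_rpow (k p ξ : ℝ) :
    HasDerivAt (fun x => (1 / Real.cosh (k * x)) ^ p)
      (-(p * k * (Real.sinh (k * ξ) / Real.cosh (k * ξ)) * (1 / Real.cosh (k * ξ)) ^ p)) ξ := by
  have hc : 0 < Real.cosh (k * ξ) := Real.cosh_pos _
  have hlin : HasDerivAt (fun x : ℝ => k * x) k ξ := by
    simpa using (hasDerivAt_id ξ).const_mul k
  have hinv := hlin.cosh.fun_inv hc.ne'
  simp only [one_div]
  convert hinv.rpow_const (p := p) (Or.inl (inv_ne_zero hc.ne')) using 1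
  rw [Real.rpow_sub_one (inv_ne_zero hc.ne')]
  field_simp

/-- The sublinear sech-profile solitary wave
U(ξ) = |A/B|^{1/(1−m)}·sech(((1−m)√|A|/2)·ξ)^{2/(1−m)}, 0 < m < 1, A, B < 0,
is positive and satisfies U'² = B·U^{3−m} − A·U². -/
theorem kp_sech_soliton_sublinear
    (m A B : ℝ) (hm1 : 0 < m) (hm2 : m < 1) (hA : A < 0) (hB : B < 0)
    (U : ℝ → ℝ)
    (hU : U = fun ξ => |A / B| ^ (1 / (1 - m))
      * (1 / Real.cosh ((1 - m) * Real.sqrt |A| / 2 * ξ)) ^ (2 / (1 - m))) :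
    (∀ ξ : ℝ, 0 < U ξ)
    ∧ ∀ ξ : ℝ, deriv U ξ ^ 2 = B * U ξ ^ (3 - m) - A * U ξ ^ 2 := by
  have hAB : 0 < A / B := div_pos_of_neg_of_neg hA hB
  have hm : (1 - m) ≠ 0 := by linarith
  have hpos : ∀ ξ : ℝ, 0 < U ξ := by
    intro ξ
    rw [hU]
    have := Real.cosh_pos ((1 - m) * Real.sqrt |A| / 2 * ξ)
    have := abs_pos.mpr hAB.ne'
    positivity
  refine ⟨hpos, fun ξ => ?_⟩
  set k := (1 - m) * Real.sqrt |A| / 2 with hk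
  have hc : 0 < Real.cosh (k * ξ) := Real.cosh_pos _
  have hderiv : deriv U ξ = -(Real.sqrt |A| * (Real.sinh (k * ξ) / Real.cosh (k * ξ)) * U ξ) := by
    have hd := (hasDerivAt_one_div_cosh_rpow k (2 / (1 - m)) ξ).const_mul (|A / B| ^ (1 / (1 - m)))
    have hpk : 2 / (1 - m) * k = Real.sqrt |A| := by
      rw [hk]; field_simp
    rw [hpk] at hd
    rw [hU, hd.deriv]
    ring
  have hpow : U ξ ^ (1 - m) = A / B * (1 / Real.cosh (k * ξ)) ^ 2 := by
    simp only [hU]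
    rw [Real.mul_rpow (by positivity) (by positivity), ← Real.rpow_mul (abs_nonneg _),
      ← Real.rpow_mul (by positivity), div_mul_cancel₀ _ hm, div_mul_cancel₀ _ hm,
      Real.rpow_one, abs_of_pos hAB, Real.rpow_two]
  have hsplit : U ξ ^ (3 - m) = U ξ ^ (1 - m) * U ξ ^ 2 := by
    rw [← Real.rpow_two, ← Real.rpow_add (hpos ξ)]
    congr 1
    ring
  have hsqrt : Real.sqrt |A| ^ 2 = -A := by
    rw [Real.sq_sqrt (abs_nonneg _), abs_of_neg hA]
  have hB' : B ≠ 0 := hB.ne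
  rw [hderiv, hsplit, hpow, neg_sq, mul_pow, mul_pow, hsqrt, div_pow, Real.sinh_sq]
  field_simp
  ring
end

section
/- Let 1/2 < m < 1 and A, B < 0, and define U(ξ) := (|B/A| + ((1−m)²·|A|/4)·ξ²)^{−1/(1−m)}. Then U is strictly positive and satisfies U'(ξ)² = B·U(ξ)^{4−2m} − A·U(ξ)^{3−m} for every ξ ∈ ℝ (real powers of the positive function U). -/
open Real

/-- The sublinear heavy-tail solitary wave
U(ξ) = (|B/A| + ((1−m)²|A|/4)·ξ²)^{−1/(1−m)}, 1/2 < m < 1, A, B < 0,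
is positive and satisfies U'² = B·U^{4−2m} − A·U^{3−m}. -/
theorem kp_heavy_tail_soliton_sublinear
    (m A B : ℝ) (hm1 : 1 / 2 < m) (hm2 : m < 1) (hA : A < 0) (hB : B < 0)
    (U : ℝ → ℝ)
    (hU : U = fun ξ => (|B / A| + (1 - m) ^ 2 * |A| / 4 * ξ ^ 2) ^ (-(1 / (1 - m)))) :
    (∀ ξ : ℝ, 0 < U ξ)
    ∧ ∀ ξ : ℝ, deriv U ξ ^ 2 = B * U ξ ^ (4 - 2 * m) - A * U ξ ^ (3 - m) := by
  have hBA : 0 < B / A := div_pos_of_neg_of_neg hB hA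
  have h1m : 0 < 1 - m := by linarith
  rw [abs_of_pos hBA, abs_of_neg hA] at hU
  subst hU
  have hbase (ξ : ℝ) : 0 < B / A + (1 - m) ^ 2 * -A / 4 * ξ ^ 2 := by
    have : 0 ≤ (1 - m) ^ 2 * -A / 4 * ξ ^ 2 := by
      have : 0 < -A := by linarith
      positivity
    linarith
  refine ⟨fun ξ => rpow_pos_of_pos (hbase ξ) _, fun ξ => ?_⟩
  have hder : HasDerivAt (fun ξ : ℝ => B / A + (1 - m) ^ 2 * -A / 4 * ξ ^ 2)
      ((1 - m) ^ 2 * -A / 4 * (2 * ξ)) ξ := by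
    have hpow : HasDerivAt (fun ξ : ℝ => ξ ^ 2) (2 * ξ) ξ := by simpa using hasDerivAt_pow 2 ξ
    exact (hpow.const_mul _).const_add _
  rw [(hder.rpow_const (p := -(1 / (1 - m))) (Or.inl (hbase ξ).ne')).deriv]
  have hg := hbase ξ
  obtain ⟨g, hgdef⟩ : ∃ g, g = B / A + (1 - m) ^ 2 * -A / 4 * ξ ^ 2 := ⟨_, rfl⟩
  simp only [← hgdef] at hg ⊢
  have hexp₁ : -(1 / (1 - m)) * (4 - 2 * m) = (-(1 / (1 - m)) - 1) * 2 := by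
    field_simp
    ring
  have hexp₂ : -(1 / (1 - m)) * (3 - m) = (-(1 / (1 - m)) - 1) * 2 + 1 := by
    field_simp
    ring
  have hsq : (g ^ (-(1 / (1 - m)) - 1)) ^ 2 = g ^ ((-(1 / (1 - m)) - 1) * 2) := by
    rw [rpow_mul hg.le, rpow_two]
  rw [← rpow_mul hg.le, ← rpow_mul hg.le, hexp₁, hexp₂, rpow_add_one hg.ne', mul_pow, hsq,
    hgdef]
  field_simp [hA.ne]
  ring
end

section
/- Let n > 1, let a, b, κ > 0, and set α := (2nκ/((n+1)a))^{1/(n−1)}, γ := ((n−1)/(2n))·√(a/b), and L := (n/(n−1))·√(b/a)·π. Define U(ξ) := α·cos(γ·ξ)^{2/(n−1)} for |ξ| < L (where cos(γ·ξ) > 0, real powers). Then −κ·U(ξ) + a·U(ξ)^n + b·(U^n)''(ξ) = 0 for every ξ with |ξ| < L. -/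
open Real

theorem hasDerivAt_cos_mul_rpow (γ p x : ℝ) (hx : 0 < cos (γ * x)) :
    HasDerivAt (fun y => cos (γ * y) ^ p) (-(γ * p) * (sin (γ * x) * cos (γ * x) ^ (p - 1))) x := by
  have h : HasDerivAt (fun y => cos (γ * y)) (-sin (γ * x) * γ) x := by
    simpa using ((hasDerivAt_id x).const_mul γ).cos
  convert h.rpow_const (p := p) (Or.inl hx.ne') using 1
  ring

theorem hasDerivAt_sin_mul_cos_mul_rpow (γ p x : ℝ) (hx : 0 < cos (γ * x)) :
    HasDerivAt (fun y => sin (γ * y) * cos (γ * y) ^ (p - 1))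
      (γ * (p * cos (γ * x) ^ p - (p - 1) * cos (γ * x) ^ (p - 2))) x := by
  have h : HasDerivAt (fun y => sin (γ * y)) (cos (γ * x) * γ) x := by
    simpa using ((hasDerivAt_id x).const_mul γ).sin
  refine (h.mul (hasDerivAt_cos_mul_rpow γ (p - 1) x hx)).congr_deriv ?_
  have h₁ : cos (γ * x) ^ (p - 1) = cos (γ * x) ^ (p - 2) * cos (γ * x) := by
    rw [← rpow_add_one hx.ne']; ring_nf
  have h₂ : cos (γ * x) ^ p = cos (γ * x) ^ (p - 2) * cos (γ * x) * cos (γ * x) := by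
    rw [← h₁, ← rpow_add_one hx.ne']; ring_nf
  rw [show p - 1 - 1 = p - 2 by ring, h₁, h₂]
  linear_combination -γ * (p - 1) * cos (γ * x) ^ (p - 2) * sin_sq_add_cos_sq (γ * x)

/-- Where `cos (γ x)` is positive, `y ↦ cos (γ y) ^ p` has second derivative
`γ² (p (p - 1) cos (γ x) ^ (p - 2) - p² cos (γ x) ^ p)`. -/
theorem deriv_deriv_const_mul_cos_mul_rpow (A γ p x : ℝ) (hx : 0 < cos (γ * x)) :
    deriv (deriv fun y => A * cos (γ * y) ^ p) x =
      A * γ ^ 2 * (p * (p - 1) * cos (γ * x) ^ (p - 2) - p ^ 2 * cos (γ * x) ^ p) := by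
  have hpos : ∀ᶠ y in nhds x, 0 < cos (γ * y) :=
    (by fun_prop : Continuous fun y => cos (γ * y)).continuousAt.eventually_const_lt hx
  have h : deriv (fun y => A * cos (γ * y) ^ p) =ᶠ[nhds x]
      fun y => A * (-(γ * p) * (sin (γ * y) * cos (γ * y) ^ (p - 1))) := by
    filter_upwards [hpos] with y hy
    exact ((hasDerivAt_cos_mul_rpow γ p y hy).const_mul A).deriv
  rw [h.deriv_eq,
    (((hasDerivAt_sin_mul_cos_mul_rpow γ p x hx).const_mul (-(γ * p))).const_mul A).deriv]
  ring

/-- The cosine compacton profile U(ξ) = α·cos(γξ)^{2/(n−1)} solves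
the twice-integrated travelling wave ODE −κ·U + a·U^n + b·(U^n)'' = 0 on |ξ| < L. -/
theorem kp_cosine_compacton
    (n a b κ : ℝ) (hn : 1 < n) (ha : 0 < a) (hb : 0 < b) (hκ : 0 < κ)
    (α γ L : ℝ)
    (hα : α = (2 * n * κ / ((n + 1) * a)) ^ (1 / (n - 1)))
    (hγ : γ = (n - 1) / (2 * n) * Real.sqrt (a / b))
    (hL : L = n / (n - 1) * Real.sqrt (b / a) * π)
    (U : ℝ → ℝ) (hU : U = fun ξ => α * Real.cos (γ * ξ) ^ (2 / (n - 1))) :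
    ∀ ξ : ℝ, |ξ| < L →
      -κ * U ξ + a * U ξ ^ n + b * deriv (deriv (fun x => U x ^ n)) ξ = 0 := by
  intro ξ hξ
  have hn₀ : 0 < n := by linarith
  have hn₁ : 0 < n - 1 := by linarith
  have hγ₀ : 0 < γ := by rw [hγ]; positivity
  have hbase : 0 < 2 * n * κ / ((n + 1) * a) := by positivity
  have hα₀ : 0 < α := by rw [hα]; positivity
  have hsqrt : √(a / b) * √(b / a) = 1 := by
    rw [← sqrt_mul (by positivity), div_mul_div_cancel₀ hb.ne', div_self ha.ne', sqrt_one]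
  have hγL : γ * L = π / 2 := by
    rw [hγ, hL]
    field_simp
    linear_combination hsqrt
  have hcos : 0 < cos (γ * ξ) := by
    have h := mul_lt_mul_of_pos_left hξ hγ₀
    rw [hγL, ← abs_of_pos hγ₀, ← abs_mul] at h
    exact cos_pos_of_mem_Ioo (abs_lt.mp h)
  have hUn : ∀ x, 0 < cos (γ * x) → U x ^ n = α ^ n * cos (γ * x) ^ (2 * n / (n - 1)) := by
    intro x hx
    rw [hU, mul_rpow hα₀.le (by positivity), ← rpow_mul hx.le]
    ring_nf
  have hpos : ∀ᶠ y in nhds ξ, 0 < cos (γ * y) :=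
    (by fun_prop : Continuous fun y => cos (γ * y)).continuousAt.eventually_const_lt hcos
  have hUn' : (fun x => U x ^ n) =ᶠ[nhds ξ]
      fun x => α ^ n * cos (γ * x) ^ (2 * n / (n - 1)) := hpos.mono hUn
  rw [hUn'.deriv.deriv_eq, deriv_deriv_const_mul_cos_mul_rpow _ _ _ _ hcos, hUn ξ hcos, hU,
    show 2 * n / (n - 1) - 2 = 2 / (n - 1) by field_simp; ring]
  have hαn : α ^ n = 2 * n * κ / ((n + 1) * a) * α := by
    have h : α ^ (n - 1) = 2 * n * κ / ((n + 1) * a) := by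
      rw [hα, ← rpow_mul hbase.le, one_div_mul_cancel hn₁.ne', rpow_one]
    rw [← h, ← rpow_add_one hα₀.ne', sub_add_cancel]
  have hγ_sq : γ ^ 2 = (n - 1) ^ 2 / (4 * n ^ 2) * (a / b) := by
    rw [hγ, mul_pow, sq_sqrt (by positivity)]
    ring
  rw [hαn, hγ_sq]
  field_simp
  ring
end

section
/- Let n > 1, let a, b, κ > 0, and set α := (2nκ/((n+1)a))^{1/(n−1)} and γ := ((n−1)/(2n))·√(a/b). Define U(ξ) := α·sin(γ·ξ)^{2/(n−1)} for 0 < ξ < π/γ (where sin(γ·ξ) > 0, real powers). Then −κ·U(ξ) + a·U(ξ)^n + b·(U^n)''(ξ) = 0 for every ξ with 0 < ξ < π/γ. -/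
open Real

/-- First derivative of a real power of `sin (γ x)` where the sine is positive. -/
theorem hasDerivAt_sin_mul_rpow (γ p : ℝ) {x : ℝ} (hx : 0 < sin (γ * x)) :
    HasDerivAt (fun y => sin (γ * y) ^ p)
      (γ * p * (sin (γ * x) ^ (p - 1) * cos (γ * x))) x := by
  have h : HasDerivAt (fun y => sin (γ * y)) (cos (γ * x) * γ) x :=
    (hasDerivAt_const_mul γ).sin
  convert h.rpow_const (p := p) (Or.inl hx.ne') using 1
  ring

/-- Second derivative of a real power of `sin (γ x)` where the sine is positive. -/
theorem deriv_deriv_sin_mul_rpow (γ p : ℝ) {x : ℝ} (hx : 0 < sin (γ * x)) :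
    deriv (deriv fun y => sin (γ * y) ^ p) x =
      γ ^ 2 * (p * (p - 1) * sin (γ * x) ^ (p - 2) - p ^ 2 * sin (γ * x) ^ p) := by
  have hpos : ∀ᶠ y in nhds x, 0 < sin (γ * y) :=
    (by fun_prop : ContinuousAt (fun y => sin (γ * y)) x).eventually_const_lt hx
  have hderiv : (deriv fun y => sin (γ * y) ^ p) =ᶠ[nhds x]
      fun y => γ * p * (sin (γ * y) ^ (p - 1) * cos (γ * y)) :=
    hpos.mono fun y hy => (hasDerivAt_sin_mul_rpow γ p hy).deriv
  have hcos : HasDerivAt (fun y => cos (γ * y)) (-sin (γ * x) * γ) x :=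
    (hasDerivAt_const_mul γ).cos
  rw [hderiv.deriv_eq]
  refine (((hasDerivAt_sin_mul_rpow γ (p - 1) hx).mul hcos).const_mul (γ * p)).deriv.trans ?_
  have h₁ : sin (γ * x) ^ (p - 1) = sin (γ * x) ^ (p - 2) * sin (γ * x) := by
    rw [← rpow_add_one hx.ne']; ring_nf
  have h₂ : sin (γ * x) ^ p = sin (γ * x) ^ (p - 2) * sin (γ * x) ^ 2 := by
    rw [← rpow_natCast, ← rpow_add hx]; norm_num
  have h₃ : p - 1 - 1 = p - 2 := by ring
  rw [h₃, h₁, h₂]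
  linear_combination γ ^ 2 * p * (p - 1) * sin (γ * x) ^ (p - 2) * cos_sq' (γ * x)

/-- The sine compacton profile U(ξ) = α·sin(γξ)^{2/(n−1)} solves
the twice-integrated travelling wave ODE −κ·U + a·U^n + b·(U^n)'' = 0 on 0 < ξ < π/γ. -/
theorem kp_sine_compacton
    (n a b κ : ℝ) (hn : 1 < n) (ha : 0 < a) (hb : 0 < b) (hκ : 0 < κ)
    (α γ : ℝ)
    (hα : α = (2 * n * κ / ((n + 1) * a)) ^ (1 / (n - 1)))
    (hγ : γ = (n - 1) / (2 * n) * Real.sqrt (a / b))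
    (U : ℝ → ℝ) (hU : U = fun ξ => α * Real.sin (γ * ξ) ^ (2 / (n - 1))) :
    ∀ ξ : ℝ, 0 < ξ → ξ < π / γ →
      -κ * U ξ + a * U ξ ^ n + b * deriv (deriv (fun x => U x ^ n)) ξ = 0 := by
  intro ξ hξ hξγ
  have hn1 : n - 1 ≠ 0 := by linarith
  have hγ0 : 0 < γ := by
    rw [hγ]
    have : 0 < n - 1 := by linarith
    positivity
  have hs : 0 < sin (γ * ξ) :=
    sin_pos_of_pos_of_lt_pi (mul_pos hγ0 hξ) (by rwa [lt_div_iff₀' hγ0] at hξγ)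
  have hbase : 0 < 2 * n * κ / ((n + 1) * a) := by positivity
  have hα0 : 0 < α := hα ▸ rpow_pos_of_pos hbase _
  have hαpow : α ^ n = 2 * n * κ / ((n + 1) * a) * α := by
    have h : α ^ (n - 1) = 2 * n * κ / ((n + 1) * a) := by
      rw [hα, ← rpow_mul hbase.le, one_div_mul_cancel hn1, rpow_one]
    rw [← h, ← rpow_add_one hα0.ne', sub_add_cancel]
  have hγsq : γ ^ 2 = ((n - 1) / (2 * n)) ^ 2 * (a / b) := by
    rw [hγ, mul_pow, sq_sqrt (by positivity)]
  have hUn : ∀ x, 0 < sin (γ * x) →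
      U x ^ n = α ^ n * sin (γ * x) ^ (2 * n / (n - 1)) := by
    intro x hx
    simp only [hU]
    rw [mul_rpow hα0.le (rpow_nonneg hx.le _), ← rpow_mul hx.le, div_mul_eq_mul_div]
  have hpos : ∀ᶠ x in nhds ξ, 0 < sin (γ * x) :=
    (by fun_prop : ContinuousAt (fun x => sin (γ * x)) ξ).eventually_const_lt hs
  have hUn_eventually : (fun x => U x ^ n) =ᶠ[nhds ξ]
      fun x => α ^ n * sin (γ * x) ^ (2 * n / (n - 1)) := hpos.mono hUn
  have hexp : 2 * n / (n - 1) - 2 = 2 / (n - 1) := by field_simp; ring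
  rw [hUn_eventually.deriv.deriv_eq, hUn ξ hs]
  simp only [deriv_const_mul_field']
  rw [deriv_deriv_sin_mul_rpow _ _ hs, hexp, hαpow, hγsq, hU]
  field_simp
  ring
end

section
/- Let n > 0, let a, b, α > 0, and set β := a/(12·b·α^{n/2}) and L := 1/√β. Define U(ξ) := α·(1 − β·ξ²)^{2/n} for |ξ| < L (real powers of the positive base). Then a·U(ξ)^{n/2} + b·(U^n)''(ξ) = (2/3)·a·α^{n/2} for every ξ with |ξ| < L. -/
open Real

lemma one_sub_mul_sq_pos {β ξ : ℝ} (hβ : 0 < β) (hξ : |ξ| < 1 / √β) : 0 < 1 - β * ξ ^ 2 := by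
  have hlt : |ξ| * √β < 1 := (lt_div_iff₀ (sqrt_pos.mpr hβ)).mp hξ
  have hsq : (|ξ| * √β) ^ 2 < 1 := pow_lt_one₀ (by positivity) hlt two_ne_zero
  rw [mul_pow, sq_abs, sq_sqrt hβ.le] at hsq
  linarith

lemma mul_rpow_two_div_rpow {α p n : ℝ} (hα : 0 < α) (hp : 0 < p) (hn : n ≠ 0) (r : ℝ) :
    (α * p ^ (2 / n)) ^ (r * n / 2) = α ^ (r * n / 2) * p ^ r := by
  rw [mul_rpow hα.le (rpow_nonneg hp.le _), ← rpow_mul hp.le]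
  congr 2
  field_simp

lemma deriv_deriv_mul_one_sub_mul_sq_sq (c β ξ : ℝ) :
    deriv (deriv fun x : ℝ => c * (1 - β * x ^ 2) ^ 2) ξ =
      c * (-4 * β + 12 * β ^ 2 * ξ ^ 2) := by
  have hd (x : ℝ) : HasDerivAt (fun x : ℝ => c * (1 - β * x ^ 2) ^ 2)
      (c * (-4 * β * x + 4 * β ^ 2 * x ^ 3)) x := by
    refine ((((hasDerivAt_pow 2 x).const_mul β).const_sub 1).pow 2 |>.const_mul c).congr_deriv ?_
    push_cast
    ring
  rw [funext fun x => (hd x).deriv]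
  refine ((((hasDerivAt_id ξ).const_mul (-4 * β)).add
    ((hasDerivAt_pow 3 ξ).const_mul (4 * β ^ 2))).const_mul c |>.congr_deriv ?_).deriv
  push_cast
  ring

/-- The algebraic compacton profile U(ξ) = α·(1 − βξ²)^{2/n}
with β = a/(12bα^{n/2}) satisfies a·U^{n/2} + b·(U^n)'' = (2/3)·a·α^{n/2} on |ξ| < L. -/
theorem kp_algebraic_weak_compacton
    (n a b α : ℝ) (hn : 0 < n) (ha : 0 < a) (hb : 0 < b) (hα : 0 < α)
    (β L : ℝ)
    (hβ : β = a / (12 * b * α ^ (n / 2)))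
    (hL : L = 1 / Real.sqrt β)
    (U : ℝ → ℝ) (hU : U = fun ξ => α * (1 - β * ξ ^ 2) ^ (2 / n)) :
    ∀ ξ : ℝ, |ξ| < L →
      a * U ξ ^ (n / 2) + b * deriv (deriv (fun x => U x ^ n)) ξ
        = 2 / 3 * a * α ^ (n / 2) := by
  intro ξ hξ
  have hβ_pos : 0 < β := by rw [hβ]; positivity
  have hpos {x : ℝ} (hx : |x| < L) : 0 < 1 - β * x ^ 2 :=
    one_sub_mul_sq_pos hβ_pos (hL ▸ hx)
  have hhalf : U ξ ^ (n / 2) = α ^ (n / 2) * (1 - β * ξ ^ 2) := by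
    simpa [hU] using mul_rpow_two_div_rpow hα (hpos hξ) hn.ne' 1
  have hpow : (fun x => U x ^ n) =ᶠ[nhds ξ] fun x => α ^ n * (1 - β * x ^ 2) ^ 2 := by
    filter_upwards [(isOpen_lt continuous_abs continuous_const).mem_nhds hξ] with x hx
    simpa [hU] using mul_rpow_two_div_rpow hα (hpos hx) hn.ne' 2
  have hsq : α ^ n = (α ^ (n / 2)) ^ 2 := by
    rw [← rpow_mul_natCast hα.le]
    norm_num
  have hβ_mul : 12 * b * α ^ (n / 2) * β = a := by
    rw [hβ]
    field_simp
  rw [hpow.deriv.deriv_eq, deriv_deriv_mul_one_sub_mul_sq_sq, hhalf, hsq]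
  linear_combination (α ^ (n / 2) * (-1 / 3 + β * ξ ^ 2)) * hβ_mul
end

section
/- Let n > 1, let a, b, κ > 0, and set β := ((3n+1)·κ/(2(n+1)·a))^{2/(n−1)} and γ := (n−1)²·(n+1)·a²/(2·(3n+1)²·κ·n·b). Define U(ξ) := β·(1 − γ·ξ²)^{2/(n−1)} for |ξ| < 1/√γ (real powers of the positive base). Then −κ·U(ξ) + a·U(ξ)^{(n+1)/2} + b·(U^n)''(ξ) = 0 for every ξ with |ξ| < 1/√γ. -/
open Real

theorem hasDerivAt_one_sub_mul_sq_rpow (γ r x : ℝ) (hx : 0 < 1 - γ * x ^ 2) :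
    HasDerivAt (fun y : ℝ => (1 - γ * y ^ 2) ^ r)
      (-(2 * γ * r) * (x * (1 - γ * x ^ 2) ^ (r - 1))) x := by
  have h : HasDerivAt (fun y : ℝ => 1 - γ * y ^ 2) (-(2 * γ * x)) x := by
    refine (((hasDerivAt_pow 2 x).const_mul γ).const_sub 1).congr_deriv ?_
    push_cast
    ring
  convert h.rpow_const (p := r) (Or.inl hx.ne') using 1
  ring

theorem eventually_one_sub_mul_sq_pos (γ x : ℝ) (hx : 0 < 1 - γ * x ^ 2) :
    ∀ᶠ y in nhds x, 0 < 1 - γ * y ^ 2 :=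
  (by fun_prop : Continuous fun y : ℝ => 1 - γ * y ^ 2).continuousAt.eventually_const_lt hx

theorem deriv_deriv_one_sub_mul_sq_rpow (γ p x : ℝ) (hx : 0 < 1 - γ * x ^ 2) :
    deriv (deriv fun y : ℝ => (1 - γ * y ^ 2) ^ (p + 2)) x =
      2 * γ * (p + 2) * (1 - γ * x ^ 2) ^ p *
        (2 * (p + 1) - (2 * p + 3) * (1 - γ * x ^ 2)) := by
  have h : deriv (fun y : ℝ => (1 - γ * y ^ 2) ^ (p + 2)) =ᶠ[nhds x]
      fun y => -(2 * γ * (p + 2)) * (y * (1 - γ * y ^ 2) ^ (p + 1)) := by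
    filter_upwards [eventually_one_sub_mul_sq_pos γ x hx] with y hy
    rw [(hasDerivAt_one_sub_mul_sq_rpow γ (p + 2) y hy).deriv]
    ring_nf
  rw [h.deriv_eq, (((hasDerivAt_id' x).fun_mul
    (hasDerivAt_one_sub_mul_sq_rpow γ (p + 1) x hx)).const_mul (-(2 * γ * (p + 2)))).deriv,
    add_sub_cancel_right, rpow_add_one hx.ne']
  ring

/-- The algebraic compacton profile U(ξ) = β·(1 − γξ²)^{2/(n−1)}
solves −κ·U + a·U^{(n+1)/2} + b·(U^n)'' = 0 on |ξ| < 1/√γ. -/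
theorem kp_algebraic_compacton_convex
    (n a b κ : ℝ) (hn : 1 < n) (ha : 0 < a) (hb : 0 < b) (hκ : 0 < κ)
    (β γ : ℝ)
    (hβ : β = ((3 * n + 1) * κ / (2 * (n + 1) * a)) ^ (2 / (n - 1)))
    (hγ : γ = (n - 1) ^ 2 * (n + 1) * a ^ 2 / (2 * (3 * n + 1) ^ 2 * κ * n * b))
    (U : ℝ → ℝ) (hU : U = fun ξ => β * (1 - γ * ξ ^ 2) ^ (2 / (n - 1))) :
    ∀ ξ : ℝ, |ξ| < 1 / Real.sqrt γ →
      -κ * U ξ + a * U ξ ^ ((n + 1) / 2) + b * deriv (deriv (fun x => U x ^ n)) ξ = 0 := by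
  intro ξ hξ
  have hn' : 0 < n - 1 := by linarith
  have hγ0 : 0 < γ := by rw [hγ]; positivity
  have hw : 0 < 1 - γ * ξ ^ 2 := by
    rw [lt_div_iff₀ (sqrt_pos.2 hγ0)] at hξ
    have h1 : (|ξ| * √γ) ^ 2 < 1 := pow_lt_one₀ (by positivity) hξ two_ne_zero
    rw [mul_pow, sq_abs, sq_sqrt hγ0.le] at h1
    linarith
  set p := 2 / (n - 1) with hp
  set B := (3 * n + 1) * κ / (2 * (n + 1) * a) with hB
  have hB0 : 0 < B := by positivity
  have hβ0 : 0 < β := by rw [hβ]; positivity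
  have hpm : p * ((n + 1) / 2) = p + 1 := by rw [hp]; field_simp; ring
  have hpn : p * n = p + 2 := by rw [hp]; field_simp; ring
  have hβm : β ^ ((n + 1) / 2) = β * B := by
    rw [hβ, ← rpow_mul hB0.le, hpm, rpow_add_one hB0.ne']
  have hβn : β ^ n = β * B ^ 2 := by
    rw [hβ, ← rpow_mul hB0.le, hpn, rpow_add hB0, rpow_two]
  have hUn : (fun x => U x ^ n) =ᶠ[nhds ξ] fun x => β ^ n * (1 - γ * x ^ 2) ^ (p + 2) := by
    filter_upwards [eventually_one_sub_mul_sq_pos γ ξ hw] with x hx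
    simp only [hU]
    rw [mul_rpow hβ0.le (rpow_nonneg hx.le _), ← rpow_mul hx.le, hpn]
  have hUm : U ξ ^ ((n + 1) / 2) = β * B * ((1 - γ * ξ ^ 2) ^ p * (1 - γ * ξ ^ 2)) := by
    simp only [hU]
    rw [mul_rpow hβ0.le (rpow_nonneg hw.le _), ← rpow_mul hw.le, hpm, rpow_add_one hw.ne', hβm]
  rw [hUn.deriv.deriv_eq, hUm]
  simp only [deriv_const_mul_field', hβn]
  rw [deriv_deriv_one_sub_mul_sq_rpow γ p ξ hw]
  simp only [hU]
  have hconst : b * B ^ 2 * (4 * γ * (p + 2) * (p + 1)) = κ := by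
    rw [hγ, hB, hp]; field_simp; ring
  have hlin : b * B ^ 2 * (2 * γ * (p + 2) * (2 * p + 3)) = a * B := by
    rw [hγ, hB, hp]; field_simp; ring
  linear_combination β * (1 - γ * ξ ^ 2) ^ p * hconst -
    β * (1 - γ * ξ ^ 2) ^ p * (1 - γ * ξ ^ 2) * hlin
end

section
/- Let 1 < n < 2, let a, κ > 0 and b < 0, and set β := ((n+1)·a/(2κ))^{1/(n−1)} and γ := (n−1)²·κ²/((n+1)²·n·a·|b|). Define U(ξ) := β·(1 − γ·ξ²)^{1/(n−1)} for |ξ| < 1/√γ (real powers of the positive base). Then −κ·U(ξ) + a·U(ξ)^{2−n} + b·(U^n)''(ξ) = 0 for every ξ with |ξ| < 1/√γ. -/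
open Real

/-- Second derivative of a power of the parabola `1 - γ x²`. -/
lemma deriv_deriv_const_mul_parabola_rpow (c γ p : ℝ) (hp : 1 ≤ p) (ξ : ℝ) :
    deriv (deriv fun x : ℝ => c * (1 - γ * x ^ 2) ^ (p + 1)) ξ =
      c * (p + 1) * (4 * γ ^ 2 * ξ ^ 2 * p * (1 - γ * ξ ^ 2) ^ (p - 1)
        - 2 * γ * (1 - γ * ξ ^ 2) ^ p) := by
  have hw (x : ℝ) : HasDerivAt (fun x : ℝ => 1 - γ * x ^ 2) (-(2 * γ * x)) x := by
    refine (((hasDerivAt_pow 2 x).const_mul γ).const_sub 1).congr_deriv ?_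
    norm_num
    ring
  have hfirst : (deriv fun x : ℝ => c * (1 - γ * x ^ 2) ^ (p + 1)) =
      fun x => c * (-(2 * γ) * (p + 1)) * (x * (1 - γ * x ^ 2) ^ p) := by
    funext x
    have h := ((hw x).rpow_const (p := p + 1) (Or.inr (by linarith))).const_mul c
    rw [add_sub_cancel_right] at h
    rw [h.deriv]
    ring
  rw [hfirst, (((hasDerivAt_id' ξ).fun_mul
    ((hw ξ).rpow_const (p := p) (Or.inr hp))).const_mul _).deriv]
  ring

/-- The parabola `1 - γ x²` is positive inside the interval of half-width `1 / √γ`. -/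
lemma parabola_pos_of_abs_lt {γ x : ℝ} (hγ : 0 < γ) (hx : |x| < 1 / √γ) :
    0 < 1 - γ * x ^ 2 := by
  have hs : 0 < √γ := Real.sqrt_pos.2 hγ
  rw [lt_div_iff₀ hs] at hx
  have h : (|x| * √γ) ^ 2 < 1 := by
    have h0 : 0 ≤ |x| * √γ := by positivity
    nlinarith
  rw [mul_pow, sq_abs, Real.sq_sqrt hγ.le] at h
  linarith

/-- The non-convex algebraic compacton profile
U(ξ) = β·(1 − γξ²)^{1/(n−1)} solves −κ·U + a·U^{2−n} + b·(U^n)'' = 0 on |ξ| < 1/√γ. -/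
theorem kp_algebraic_compacton_nonconvex
    (n a b κ : ℝ) (hn1 : 1 < n) (hn2 : n < 2) (ha : 0 < a) (hκ : 0 < κ) (hb : b < 0)
    (β γ : ℝ)
    (hβ : β = ((n + 1) * a / (2 * κ)) ^ (1 / (n - 1)))
    (hγ : γ = (n - 1) ^ 2 * κ ^ 2 / ((n + 1) ^ 2 * n * a * |b|))
    (U : ℝ → ℝ) (hU : U = fun ξ => β * (1 - γ * ξ ^ 2) ^ (1 / (n - 1))) :
    ∀ ξ : ℝ, |ξ| < 1 / Real.sqrt γ →
      -κ * U ξ + a * U ξ ^ (2 - n) + b * deriv (deriv (fun x => U x ^ n)) ξ = 0 := by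
  intro ξ hξ
  have hn : 0 < n - 1 := by linarith
  have hnp : 0 < n + 1 := by linarith
  have hn_pos : 0 < n := by linarith
  obtain ⟨d, rfl⟩ : ∃ d, b = -d := ⟨-b, by ring⟩
  have hd : 0 < d := by linarith
  rw [abs_neg, abs_of_pos hd] at hγ
  have hγ_pos : 0 < γ := by rw [hγ]; positivity
  set B := (n + 1) * a / (2 * κ) with hB
  have hB_pos : 0 < B := by positivity
  have hβ_pos : 0 < β := by rw [hβ]; positivity
  have hβB : β ^ (n - 1) = B := by
    rw [hβ, ← Real.rpow_mul hB_pos.le, one_div_mul_cancel hn.ne', Real.rpow_one]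
  set p := 1 / (n - 1) with hp
  have hp_one : 1 ≤ p := by rw [hp, le_div_iff₀ hn]; linarith
  have hpn : p * n = p + 1 := by rw [hp]; field_simp; ring
  have hpn' : p * (2 - n) = p - 1 := by linarith
  have hpow (x m : ℝ) (hx : 0 < 1 - γ * x ^ 2) :
      U x ^ m = β ^ m * (1 - γ * x ^ 2) ^ (p * m) := by
    rw [hU, Real.mul_rpow hβ_pos.le (Real.rpow_nonneg hx.le _), ← Real.rpow_mul hx.le]
  have hw := parabola_pos_of_abs_lt hγ_pos hξ
  have hev : (fun x => U x ^ n) =ᶠ[nhds ξ]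
      fun x => β ^ n * (1 - γ * x ^ 2) ^ (p + 1) := by
    have hcont : Continuous fun x : ℝ => 1 - γ * x ^ 2 := by fun_prop
    filter_upwards [hcont.continuousAt.eventually (lt_mem_nhds hw)] with x hx
    rw [hpow x n hx, hpn]
  rw [hev.deriv.deriv_eq, deriv_deriv_const_mul_parabola_rpow _ _ _ hp_one,
    hpow ξ (2 - n) hw, hpn']
  have hβ_lin : β = β ^ (2 - n) * B := by
    rw [← hβB, ← Real.rpow_add hβ_pos]
    norm_num
  have hβ_n : β ^ n = β ^ (2 - n) * B ^ 2 := by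
    rw [← hβB, sq, ← Real.rpow_add hβ_pos, ← Real.rpow_add hβ_pos]
    congr 1
    ring
  have hw_p : (1 - γ * ξ ^ 2) ^ p = (1 - γ * ξ ^ 2) ^ (p - 1) * (1 - γ * ξ ^ 2) := by
    rw [← Real.rpow_add_one hw.ne', sub_add_cancel]
  have hU_ξ : U ξ = β ^ (2 - n) * B * ((1 - γ * ξ ^ 2) ^ (p - 1) * (1 - γ * ξ ^ 2)) := by
    rw [← hβ_lin, ← hw_p, hU]
  rw [hU_ξ, hβ_n, hw_p]
  generalize β ^ (2 - n) = s
  generalize (1 - γ * ξ ^ 2) ^ (p - 1) = v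
  have hlow : a = 4 * d * γ * (p + 1) * p * B ^ 2 := by
    rw [hγ, hp, hB]
    field_simp
    ring
  have hhigh : κ = d * γ * (p + 1) * (4 * p + 2) * B := by
    rw [hγ, hp, hB]
    field_simp
    ring
  linear_combination s * v * hlow - s * v * B * (1 - γ * ξ ^ 2) * hhigh
end

section
/- Let m, n, a, b, μ, ν be real numbers, let s ∈ {−1, 1}, and let u : ℝ³ → ℝ, (t,x,y) ↦ u(t,x,y), be a smooth, strictly positive solution of the KP(m,n) equation ∂x(∂t u + a·∂x(u^m) + b·∂x³(u^n)) + s·∂y² u = 0. With ξ := x + μ·y − ν·t, the following conservation law identity holds at every point: ∂t(−u) + ∂x(ξ·(∂t u + a·∂x(u^m) + b·∂x³(u^n)) − a·u^m − b·∂x²(u^n)) + ∂y(s·ξ·∂y u − s·μ·u) = 0. -/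
open Real

/-- The derivative of a smooth function of one real variable is smooth. -/
theorem contDiff_infty_deriv {f : ℝ → ℝ} (hf : ContDiff ℝ (⊤ : ℕ∞) f) :
    ContDiff ℝ (⊤ : ℕ∞) (deriv f) :=
  (contDiff_infty_iff_deriv.1 hf).2

/-- Partial derivatives in the first variable of a jointly smooth function are smooth in the
second variable. -/
theorem contDiff_deriv_fst_of_contDiff {u : ℝ → ℝ → ℝ → ℝ}
    (hu : ContDiff ℝ (⊤ : ℕ∞) (fun p : ℝ × ℝ × ℝ => u p.1 p.2.1 p.2.2)) (t y : ℝ) :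
    ContDiff ℝ (⊤ : ℕ∞) (fun x : ℝ => deriv (fun t' : ℝ => u t' x y) t) := by
  have hfd : ContDiff ℝ (⊤ : ℕ∞)
      (fderiv ℝ (fun p : ℝ × ℝ × ℝ => u p.1 p.2.1 p.2.2)) :=
    (contDiff_infty_iff_fderiv.1 hu).2
  have heq : (fun x : ℝ => deriv (fun t' : ℝ => u t' x y) t) = fun x : ℝ =>
      fderiv ℝ (fun p : ℝ × ℝ × ℝ => u p.1 p.2.1 p.2.2) (t, x, y) (1, 0, 0) := by
    funext x
    have hcurve : HasDerivAt (fun t' : ℝ => ((t', x, y) : ℝ × ℝ × ℝ)) (1, 0, 0) t :=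
      (hasDerivAt_id t).prodMk (hasDerivAt_const t (x, y))
    have hdiff := (hu.differentiable (by simp) (t, x, y)).hasFDerivAt
    exact (hdiff.comp_hasDerivAt t hcurve).deriv
  rw [heq]
  exact (hfd.comp (contDiff_const.prodMk (contDiff_id.prodMk contDiff_const))).clm_apply
    contDiff_const

/-- The mass conservation law of the KP(m,n) equation:
D_t(−u) + D_x(ξ·(u_t + a(u^m)_x + b(u^n)_{xxx}) − a·u^m − b·(u^n)_{xx})
+ D_y(s·ξ·u_y − s·μ·u) = 0 holds on smooth positive solutions, where ξ = x + μy − νt. -/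
theorem kp_mass_conservation_law
    (m n a b μ ν s : ℝ) (hs : s = 1 ∨ s = -1)
    (u : ℝ → ℝ → ℝ → ℝ)
    (hsmooth : ContDiff ℝ (⊤ : ℕ∞) (fun p : ℝ × ℝ × ℝ => u p.1 p.2.1 p.2.2))
    (hpos : ∀ t x y : ℝ, 0 < u t x y)
    (hKP : ∀ t x y : ℝ,
      deriv (fun x' : ℝ =>
          deriv (fun t' : ℝ => u t' x' y) t
          + a * deriv (fun x'' : ℝ => u t x'' y ^ m) x'
          + b * deriv (deriv (deriv (fun x'' : ℝ => u t x'' y ^ n))) x') x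
      + s * deriv (deriv (fun y' : ℝ => u t x y')) y = 0) :
    ∀ t x y : ℝ,
      deriv (fun t' : ℝ => -(u t' x y)) t
      + deriv (fun x' : ℝ =>
          (x' + μ * y - ν * t) *
            (deriv (fun t' : ℝ => u t' x' y) t
             + a * deriv (fun x'' : ℝ => u t x'' y ^ m) x'
             + b * deriv (deriv (deriv (fun x'' : ℝ => u t x'' y ^ n))) x')
          - a * u t x' y ^ m
          - b * deriv (deriv (fun x'' : ℝ => u t x'' y ^ n)) x') x
      + deriv (fun y' : ℝ =>
          s * (x + μ * y' - ν * t) * deriv (fun y'' : ℝ => u t x y'') y'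
          - s * μ * u t x y') y = 0 := by
  intro t x y
  have hux : ContDiff ℝ (⊤ : ℕ∞) (fun x' : ℝ => u t x' y) :=
    hsmooth.comp (contDiff_const.prodMk (contDiff_id.prodMk contDiff_const))
  have huy : ContDiff ℝ (⊤ : ℕ∞) (fun y' : ℝ => u t x y') :=
    hsmooth.comp (contDiff_const.prodMk (contDiff_const.prodMk contDiff_id))
  have hpow (r : ℝ) : ContDiff ℝ (⊤ : ℕ∞) (fun x' : ℝ => u t x' y ^ r) :=
    hux.rpow_const_of_ne fun x' => (hpos t x' y).ne'
  have hdiff {f : ℝ → ℝ} (hf : ContDiff ℝ (⊤ : ℕ∞) f) (z : ℝ) : HasDerivAt f (deriv f z) z :=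
    (hf.differentiable (by simp) z).hasDerivAt
  have hn₂ := contDiff_infty_deriv (contDiff_infty_deriv (hpow n))
  have hQ : ContDiff ℝ (⊤ : ℕ∞) (fun x' : ℝ => deriv (fun t' : ℝ => u t' x' y) t
      + a * deriv (fun x'' : ℝ => u t x'' y ^ m) x'
      + b * deriv (deriv (deriv (fun x'' : ℝ => u t x'' y ^ n))) x') :=
    ((contDiff_deriv_fst_of_contDiff hsmooth t y).add
      (contDiff_const.mul (contDiff_infty_deriv (hpow m)))).add
      (contDiff_const.mul (contDiff_infty_deriv hn₂))
  have hX := (((((hasDerivAt_id' x).add_const (μ * y)).sub_const (ν * t)).fun_mul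
    (hdiff hQ x)).fun_sub ((hdiff (hpow m) x).const_mul a)).fun_sub ((hdiff hn₂ x).const_mul b)
  have hY := (((((((hasDerivAt_id' y).const_mul μ).const_add x).sub_const (ν * t)).const_mul
    s).fun_mul (hdiff (contDiff_infty_deriv huy) y))).fun_sub ((hdiff huy y).const_mul (s * μ))
  rw [deriv.fun_neg, hX.deriv, hY.deriv]
  linear_combination (x + μ * y - ν * t) * hKP t x y
end
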